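/- Assume char F ≠ p and F contains no primitive p-th root of unity. Then for every m ≥ 1 there is an isomorphism of R_m[G]-modules J_m ≅ ⊕_{i=0}^{n} Y_i, where each Y_i is a free R_m[G_i]-module of rank e_i(K/F). -/

import Mathlib

/-!
Common setup.  Throughout, `K/F` is a cyclic Galois extension of degree `p^n`
with Galois group `G = Gal(K/F)` generated by `σ`.  For `0 ≤ i ≤ n`, `K_i`
denotes the intermediate field of degree `p^i` over `F`, realized here via its
unit group `KiU p σ i` (the units of `K` fixed by `σ^{p^i}`), and
`G_i = Gal(K_i/F)`.  For `m ≥ 1`, `R_m = ℤ/p^m` and `J_m = K^×/K^{×p^m}`.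
-/

namespace MSS

variable {F K : Type*} [Field F] [Field K] [Algebra F K]

/-- Action of a field automorphism on the unit group. -/
def umap (σ : K ≃ₐ[F] K) : Kˣ →* Kˣ := Units.map (σ : K →* K)

/-- The norm from `K_j` to `F`, computed in `K` as the product of conjugates
`∏_{k < p^j} σ^k(γ)` (valid for `γ ∈ K_j`). -/
noncomputable def normHom (p : ℕ) (σ : K ≃ₐ[F] K) (j : ℕ) : Kˣ →* Kˣ :=
  ∏ k ∈ Finset.range (p ^ j), umap (σ ^ k)

/-- The unit group of the intermediate field `K_i`: the units fixed by `σ^{p^i}`. -/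
def KiU (p : ℕ) (σ : K ≃ₐ[F] K) (i : ℕ) : Subgroup Kˣ :=
  (umap (σ ^ p ^ i) / MonoidHom.id Kˣ).ker

/-- Membership in `K_a^×` for a level `a ∈ {-∞, 0, 1, …}`; level `-∞` means
the trivial group `{1}`. -/
def levelMem (p : ℕ) (σ : K ≃ₐ[F] K) (a : WithBot ℕ) (γ : Kˣ) : Prop :=
  WithBot.recBotCoe (γ = 1) (fun i => γ ∈ KiU p σ i) a

/-- `(α, δ)` represents the pair `(a, d)`:  `σ(α)·α^{-d} = ∏_{i=0}^m δ_i^{p^i}` with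
`δ_i ∈ K_{a_i}^×` for `i < m`, and
`ξ_p = N_{K/F}(α)^{(d-1)/p} · N_{K_{n-1}/F}(δ_0) · ∏_{i=1}^m N_{K/F}(δ_i)^{p^{i-1}}`. -/
noncomputable def Represents (p n : ℕ) (σ : K ≃ₐ[F] K) (ξ : Kˣ) {m : ℕ}
    (a : Fin m → WithBot ℕ) (d : ℤ) (α : Kˣ) (δ : ℕ → Kˣ) : Prop :=
  (∀ i : Fin m, levelMem p σ (a i) (δ i)) ∧
  umap σ α = α ^ d * ∏ i ∈ Finset.range (m + 1), δ i ^ p ^ i ∧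
  ξ = normHom p σ n α ^ ((d - 1) / (p : ℤ)) * normHom p σ (n - 1) (δ 0) *
      ∏ i ∈ Finset.Icc 1 m, normHom p σ n (δ i) ^ p ^ (i - 1)

/-- `(a, d)` is a norm pair of length `m`: `a ∈ {-∞,0,…,n}^m` with `a_0 < n`,
`d ∈ U_1`, and some `(α, δ)` represents `(a, d)`. -/
noncomputable def IsNormPair (p n : ℕ) (σ : K ≃ₐ[F] K) (ξ : Kˣ) {m : ℕ}
    (a : Fin m → WithBot ℕ) (d : ℤ) : Prop :=
  (∀ i, a i ≤ (n : WithBot ℕ)) ∧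
  (∀ h0 : 0 < m, a ⟨0, h0⟩ < (n : WithBot ℕ)) ∧
  (p : ℤ) ∣ d - 1 ∧
  ∃ (α : Kˣ) (δ : ℕ → Kˣ), Represents p n σ ξ a d α δ

/-- Strict lexicographic order on norm vectors (with `-∞` smallest). -/
def vecLT {m : ℕ} (a a' : Fin m → WithBot ℕ) : Prop :=
  ∃ k : Fin m, (∀ j : Fin m, j < k → a j = a' j) ∧ a k < a' k

/-- The order `d ≤_m d'` on twists: `d' ∈ U_i → d ∈ U_i` for `1 ≤ i ≤ m`, except
when `p = 2` and `d, d' ∉ U_2`, in which case `d' ∈ -U_i → d ∈ -U_i` for `2 ≤ i ≤ m`. -/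
def twistLE (p m : ℕ) (d d' : ℤ) : Prop :=
  ((p = 2 ∧ ¬ (4 : ℤ) ∣ (d - 1) ∧ ¬ (4 : ℤ) ∣ (d' - 1)) →
    ∀ i : ℕ, 2 ≤ i → i ≤ m → ((2 : ℤ) ^ i ∣ (d' + 1)) → ((2 : ℤ) ^ i ∣ (d + 1))) ∧
  (¬ (p = 2 ∧ ¬ (4 : ℤ) ∣ (d - 1) ∧ ¬ (4 : ℤ) ∣ (d' - 1)) →
    ∀ i : ℕ, 1 ≤ i → i ≤ m → ((p : ℤ) ^ i ∣ (d' - 1)) → ((p : ℤ) ^ i ∣ (d - 1)))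

/-- The order `⪯_m` on norm pairs of length `m`. -/
def pairLE (p : ℕ) {m : ℕ} (a : Fin m → WithBot ℕ) (d : ℤ)
    (a' : Fin m → WithBot ℕ) (d' : ℤ) : Prop :=
  vecLT a a' ∨ (a = a' ∧ twistLE p m d d')

/-- `(a, d)` is a minimal norm pair of length `m`. -/
noncomputable def IsMinimalNormPair (p n : ℕ) (σ : K ≃ₐ[F] K) (ξ : Kˣ) {m : ℕ}
    (a : Fin m → WithBot ℕ) (d : ℤ) : Prop :=
  IsNormPair p n σ ξ a d ∧
  ∀ (a' : Fin m → WithBot ℕ) (d' : ℤ), IsNormPair p n σ ξ a' d' → pairLE p a d a' d'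

/-- `α` is an `m`-exceptional element. -/
noncomputable def IsExceptional (p n : ℕ) (σ : K ≃ₐ[F] K) (ξ : Kˣ) (m : ℕ) (α : Kˣ) : Prop :=
  ∃ (a : Fin m → WithBot ℕ) (d : ℤ) (δ : ℕ → Kˣ),
    IsMinimalNormPair p n σ ξ a d ∧ Represents p n σ ξ a d α δ

/-- The subgroup of `q`-th powers in `K^×`. -/
def powSub (K : Type*) [Field K] (q : ℕ) : Subgroup Kˣ := (powMonoidHom q : Kˣ →* Kˣ).range

/-- The class of a unit in `J_q := K^×/K^{×q}`. -/
def jcls (q : ℕ) (γ : Kˣ) : Kˣ ⧸ powSub K q := QuotientGroup.mk γ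

/-- The action of a field automorphism on `J_q = K^×/K^{×q}`. -/
noncomputable def jmap (q : ℕ) (τ : K ≃ₐ[F] K) : (Kˣ ⧸ powSub K q) →* Kˣ ⧸ powSub K q :=
  QuotientGroup.map _ _ (umap τ) (by
    rintro x ⟨y, rfl⟩
    exact ⟨umap τ y, by simp [powMonoidHom, map_pow]⟩)

/-- The natural map `J_q → J_{q'}` when `q' ∣ q`. -/
noncomputable def resMap (q q' : ℕ) (h : q' ∣ q) : (Kˣ ⧸ powSub K q) →* Kˣ ⧸ powSub K q' :=
  QuotientGroup.map _ _ (MonoidHom.id Kˣ) (by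
    rintro x ⟨y, rfl⟩
    obtain ⟨c, rfl⟩ := h
    exact ⟨y ^ c, by simp [powMonoidHom, ← pow_mul, mul_comm]⟩)

/-- The `R_m[G]`-submodule of `J_q` generated by the classes of the elements of `S`:
the subgroup generated by all `σ^k`-conjugates of classes of elements of `S`. -/
noncomputable def galSpan (q : ℕ) (σ : K ≃ₐ[F] K) (S : Set Kˣ) : Subgroup (Kˣ ⧸ powSub K q) :=
  Subgroup.closure {x | ∃ γ ∈ S, ∃ k : ℕ, x = jcls q (umap (σ ^ k) γ)}

/-- The subgroup `(σ-1)J_q` of `J_q`. -/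
noncomputable def augSub (q : ℕ) (σ : K ≃ₐ[F] K) : Subgroup (Kˣ ⧸ powSub K q) :=
  Subgroup.closure {x | ∃ y : Kˣ ⧸ powSub K q, x = jmap q σ y * y⁻¹}

/-- The cyclic `F_p[G]`-submodule of `J_1 = K^×/K^{×p}` generated by `[γ]_1` is a
free `F_p[G_i]`-module (on the generator `[γ]_1`): `[γ]_1` is fixed by `σ^{p^i}`
and the conjugates `σ^k [γ]_1`, `k < p^i`, are `F_p`-linearly independent. -/
noncomputable def FreeCyc (p : ℕ) (σ : K ≃ₐ[F] K) (i : ℕ) (γ : Kˣ) : Prop :=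
  jcls p (umap (σ ^ p ^ i) γ) = jcls p γ ∧
  ∀ c : Fin (p ^ i) → ZMod p,
    (∏ k : Fin (p ^ i), jcls p (umap (σ ^ (k : ℕ)) γ) ^ (c k).val) = 1 → c = 0

/-- An (indexed) internal direct sum decomposition of a commutative group. -/
def IsDirectSumDecomp {G : Type*} [CommGroup G] {ι : Sort*} (f : ι → Subgroup G) : Prop :=
  iSupIndep f ∧ (⨆ i, f i) = ⊤

/-- The subgroup `F^×` of `K^×` (units coming from the base field). -/
def Funits (F : Type*) {K : Type*} [Field F] [Field K] [Algebra F K] : Subgroup Kˣ :=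
  (Units.map (algebraMap F K : F →* K)).range

/-- The subgroup `F^{×p}` of `K^×`. -/
def FpPow (F : Type*) {K : Type*} [Field F] [Field K] [Algebra F K] (p : ℕ) : Subgroup Kˣ :=
  (Funits F).map (powMonoidHom p)

/-- The subgroup `N_{K_i/F}(K_i^×)` of `K^×`. -/
noncomputable def NormSub (p : ℕ) (σ : K ≃ₐ[F] K) (i : ℕ) : Subgroup Kˣ :=
  (KiU p σ i).map (normHom p σ i)

/-- The subgroup `N_{K_i/F}(K_i^×)·F^{×p}` of `K^×`. -/
noncomputable def NiF (p : ℕ) (σ : K ≃ₐ[F] K) (i : ℕ) : Subgroup Kˣ :=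
  NormSub p σ i ⊔ FpPow F p

/-- The `F_p`-dimension of an (elementary abelian `p`-) commutative group `Q`,
computed as the rank of `F_p ⊗_ℤ Q`. -/
noncomputable def fpdim (p : ℕ) (Q : Type*) [CommGroup Q] : Cardinal :=
  Module.rank (ZMod p) (TensorProduct ℤ (ZMod p) (Additive Q))

/-- The invariant `e_i(K/F)`: for `i < n` the `F_p`-dimension of
`N_{K_i/F}(K_i^×)F^{×p} / N_{K_{i+1}/F}(K_{i+1}^×)F^{×p}`, and for `i = n` the
`F_p`-dimension of `N_{K/F}(K^×)F^{×p}/F^{×p}`. -/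
noncomputable def eKF (p n : ℕ) (σ : K ≃ₐ[F] K) (i : ℕ) : Cardinal :=
  if i < n then
    fpdim p ((NiF p σ i) ⧸ (NiF p σ (i + 1)).subgroupOf (NiF p σ i))
  else
    fpdim p ((NiF p σ n) ⧸ (FpPow F p).subgroupOf (NiF p σ n))

/-- The group ring `R_m[G_i] = (ℤ/p^m)[ℤ/p^i]` (for the cyclic group `G_i` of order
`p^i`). -/
abbrev CycGR (p m i : ℕ) : Type :=
  MonoidAlgebra (ZMod (p ^ m)) (Multiplicative (ZMod (p ^ i)))

/-- The image of the generator `σ` of `G_i` in the group ring `R_m[G_i]`. -/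
noncomputable def gen (p m i : ℕ) : CycGR p m i :=
  MonoidAlgebra.of _ _ (Multiplicative.ofAdd (1 : ZMod (p ^ i)))

/-- Standard basis vector of the free `R_m[G]`-module on generators `e_0, …, e_m`. -/
noncomputable def sing (p n m : ℕ) (j : Fin (m + 1)) (c : CycGR p m n) :
    Fin (m + 1) → CycGR p m n :=
  Pi.single j c

/-- The relations defining the module `X_{a,d,m}`: on generators `y = e_0` and
`x_i = e_{i+1}` (`0 ≤ i < m`), we impose `(σ - d)·y = Σ_i p^i x_i`, and
`(σ^{p^{a_i}} - 1)·x_i = 0` when `a_i ≠ -∞`, resp. `x_i = 0` when `a_i = -∞`. -/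
noncomputable def XRels (p n m : ℕ) (a : Fin m → WithBot ℕ) (d : ℤ) :
    Set (Fin (m + 1) → CycGR p m n) :=
  insert
    (sing p n m 0 (gen p m n - (d : ZMod (p ^ m)) • 1) -
      ∑ i : Fin m, sing p n m i.succ ((p : CycGR p m n) ^ (i : ℕ)))
    {r | ∃ i : Fin m, r = sing p n m i.succ
      (WithBot.recBotCoe (1 : CycGR p m n) (fun k => gen p m n ^ p ^ k - 1) (a i))}

/-- The `R_m[G]`-module `X_{a,d,m}`. -/
noncomputable abbrev Xadm (p n m : ℕ) (a : Fin m → WithBot ℕ) (d : ℤ) :=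
  (Fin (m + 1) → CycGR p m n) ⧸ Submodule.span (CycGR p m n) (XRels p n m a d)

/-- Indecomposability of a module. -/
def IsIndecomposable (R M : Type*) [Ring R] [AddCommGroup M] [Module R M] : Prop :=
  (⊤ : Submodule R M) ≠ ⊥ ∧
  ∀ S T : Submodule R M, S ⊓ T = ⊥ → S ⊔ T = ⊤ → S = ⊥ ∨ T = ⊥

end MSS

universe u v
universe w

namespace MSS

section LinearAlgebra

variable {p : ℕ} [Fact p.Prime] {J : Type*} [AddCommGroup J] [Module (ZMod p) J]

theorem sub_one_pow_prime_pow (S : Module.End (ZMod p) J) (i : ℕ) :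
    (S - 1) ^ p ^ i = S ^ p ^ i - 1 := by
  have h : (Polynomial.X - 1 : Polynomial (ZMod p)) ^ p ^ i = Polynomial.X ^ p ^ i - 1 := by
    rw [sub_pow_char_pow, one_pow]
  simpa using congrArg (Polynomial.aeval S) h

theorem geom_sum_prime_pow (S : Module.End (ZMod p) J) (i : ℕ) :
    ∑ k ∈ Finset.range (p ^ i), S ^ k = (S - 1) ^ (p ^ i - 1) := by
  have h : ∑ k ∈ Finset.range (p ^ i), (Polynomial.X : Polynomial (ZMod p)) ^ k =
      (Polynomial.X - 1) ^ (p ^ i - 1) := by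
    have h0 : (Polynomial.X - 1 : Polynomial (ZMod p)) ≠ 0 := Polynomial.X_sub_C_ne_zero 1
    apply mul_right_cancel₀ h0
    rw [geom_sum_mul, ← pow_succ,
      Nat.sub_add_cancel (Nat.one_le_pow _ _ (Fact.out : p.Prime).pos), sub_pow_char_pow, one_pow]
  simpa using congrArg (Polynomial.aeval S) h

/-- The orbits of the elements `x a` under `S`, where `x a` has period dividing `p ^ l a`. -/
def orbitFamily (S : Module.End (ZMod p) J) {α : Type*} (l : α → ℕ) (x : α → J)
    (j : Σ a : α, Multiplicative (ZMod (p ^ l a))) : J :=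
  (S ^ (Multiplicative.toAdd j.2).val) (x j.1)

theorem pow_apply_eq_of_modEq {R M : Type*} [Semiring R] [AddCommMonoid M] [Module R M]
    (S : Module.End R M) {N : ℕ} {y : M} (hy : (S ^ N) y = y)
    {a b : ℕ} (h : a ≡ b [MOD N]) : (S ^ a) y = (S ^ b) y := by
  have key : ∀ a : ℕ, (S ^ a) y = (S ^ (a % N)) y := by
    intro a
    have hk : ∀ k : ℕ, (S ^ (N * k)) y = y := by
      intro k
      induction k with
      | zero => simp
      | succ k ih => rw [Nat.mul_succ, pow_add, Module.End.mul_apply, hy, ih]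
    conv_lhs => rw [← Nat.mod_add_div a N, pow_add, Module.End.mul_apply, hk]
  rw [key a, key b, h]

theorem pow_val_add_one_apply {R M : Type*} [Semiring R] [AddCommMonoid M] [Module R M]
    (S : Module.End R M) {N : ℕ} [NeZero N] {y : M}
    (hy : (S ^ N) y = y) (g : ZMod N) : (S ^ (g + 1).val) y = S ((S ^ g.val) y) := by
  rw [← Module.End.mul_apply, ← pow_succ']
  apply pow_apply_eq_of_modEq S hy
  rw [← ZMod.natCast_eq_natCast_iff]
  simp

theorem linearIndependent_orbitFamily (S : Module.End (ZMod p) J) {n : ℕ}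
    {α : Type*} (l : α → ℕ) (x : α → J) (hl : ∀ a, l a ≤ n)
    (hx : ∀ a, (S ^ p ^ l a) (x a) = x a)
    (hind : LinearIndependent (ZMod p) fun a => ((S - 1) ^ (p ^ l a - 1)) (x a)) :
    LinearIndependent (ZMod p) (orbitFamily S l x) := by
  classical
  have hp : p.Prime := Fact.out
  have hne : ∀ a, NeZero (p ^ l a) := fun a => ⟨pow_ne_zero _ hp.ne_zero⟩
  let f : (Σ a : α, Multiplicative (ZMod (p ^ l a))) → (Σ a : α, Multiplicative (ZMod (p ^ l a))) :=
    fun j => ⟨j.1, Multiplicative.ofAdd (Multiplicative.toAdd j.2 + 1)⟩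
  let Φ := Finsupp.linearCombination (ZMod p) (orbitFamily S l x)
  let D : Module.End (ZMod p) ((Σ a : α, Multiplicative (ZMod (p ^ l a))) →₀ ZMod p) :=
    Finsupp.lmapDomain (ZMod p) (ZMod p) f
  have hfi : Function.Injective f := by
    rintro ⟨a, g⟩ ⟨b, h⟩ hab
    simp only [f, Sigma.mk.injEq] at hab
    obtain ⟨rfl, h2⟩ := hab
    simpa using h2
  have hΦD : ∀ c, Φ (D c) = S (Φ c) := by
    intro c
    change Finsupp.linearCombination (ZMod p) (orbitFamily S l x) (Finsupp.mapDomain f c) = _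
    rw [Finsupp.linearCombination_mapDomain, Finsupp.apply_linearCombination]
    congr 2
    ext j
    exact pow_val_add_one_apply S (hx j.1) _
  have hfk : ∀ (k : ℕ) j, f^[k] j =
      ⟨j.1, Multiplicative.ofAdd (Multiplicative.toAdd j.2 + (k : ZMod (p ^ l j.1)))⟩ := by
    intro k
    induction k with
    | zero => intro j; simp
    | succ k ih =>
      intro j
      rw [Function.iterate_succ_apply', ih]
      simp [f, mul_assoc]
  have hDk : ∀ (k : ℕ) c, (D ^ k) c = Finsupp.mapDomain (f^[k]) c := by
    intro k
    induction k with
    | zero => intro c; simp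
    | succ k ih =>
      intro c
      rw [pow_succ', Module.End.mul_apply, ih, Function.iterate_succ', Finsupp.mapDomain_comp]
      rfl
  have hDn : (D - 1) ^ p ^ n = 0 := by
    rw [sub_one_pow_prime_pow]
    suffices h : D ^ p ^ n = 1 from sub_eq_zero.2 h
    refine LinearMap.ext fun c => ?_
    rw [hDk]
    have : f^[p ^ n] = id := by
      funext j
      rw [hfk]
      have : ((p ^ n : ℕ) : ZMod (p ^ l j.1)) = 0 :=
        (ZMod.natCast_eq_zero_iff _ _).2 (pow_dvd_pow p (hl j.1))
      simp [this]
    rw [this, Finsupp.mapDomain_id]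
    rfl
  have hinv : ∀ c, Φ c = 0 → D c = c → c = 0 := by
    intro c hc hDc
    have hstep : ∀ (k : ℕ) j, c (f^[k] j) = c j := by
      intro k
      induction k with
      | zero => intro j; rfl
      | succ k ih =>
        intro j
        rw [Function.iterate_succ_apply', ← ih j]
        conv_lhs => rw [← hDc]
        exact Finsupp.mapDomain_apply hfi c _
    have hconst : ∀ a g, c ⟨a, g⟩ = c ⟨a, 1⟩ := by
      intro a g
      have h := hstep (Multiplicative.toAdd g).val ⟨a, 1⟩
      have := hne a
      rw [hfk] at h
      simpa using h
    let i₀ : α → (Σ a : α, Multiplicative (ZMod (p ^ l a))) := fun a => ⟨a, 1⟩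
    have hi₀ : Function.Injective i₀ := fun a b h => (Sigma.mk.inj_iff.1 h).1
    let c₀ : α →₀ ZMod p := c.comapDomain i₀ hi₀.injOn
    have := fun a => hne a
    have hsum : c = Finsupp.linearCombination (ZMod p)
        (fun a => ∑ k ∈ Finset.range (p ^ l a), Finsupp.single
          (⟨a, Multiplicative.ofAdd (k : ZMod (p ^ l a))⟩ :
            Σ a : α, Multiplicative (ZMod (p ^ l a))) (1 : ZMod p)) c₀ := by
      have hs : ∀ a, (∑ k ∈ Finset.range (p ^ l a), Finsupp.single
          (⟨a, Multiplicative.ofAdd (k : ZMod (p ^ l a))⟩ :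
            Σ a : α, Multiplicative (ZMod (p ^ l a))) (1 : ZMod p)) =
          ∑ g : Multiplicative (ZMod (p ^ l a)), Finsupp.single
            (⟨a, g⟩ : Σ a : α, Multiplicative (ZMod (p ^ l a))) (1 : ZMod p) := by
        intro a
        refine Finset.sum_bij (fun k _ => Multiplicative.ofAdd (k : ZMod (p ^ l a)))
          (fun _ _ => Finset.mem_univ _) ?_ ?_ (fun _ _ => rfl)
        · intro k hk k' hk' h
          have h' : ((k : ℕ) : ZMod (p ^ l a)) = k' := h
          rw [ZMod.natCast_eq_natCast_iff] at h'
          exact Nat.ModEq.eq_of_lt_of_lt h' (Finset.mem_range.1 hk) (Finset.mem_range.1 hk')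
        · intro g _
          exact ⟨(Multiplicative.toAdd g).val, Finset.mem_range.2 (ZMod.val_lt _), by simp⟩
      simp_rw [hs]
      ext ⟨a, g⟩
      rw [Finsupp.linearCombination_apply, Finsupp.sum_apply, Finsupp.sum,
        Finset.sum_eq_single a]
      · simp only [Finsupp.smul_apply, Finsupp.finsetSum_apply]
        rw [Finset.sum_eq_single g]
        · simp [c₀, i₀, Finsupp.comapDomain_apply, hconst a g]
        · intro g' _ hg'
          rw [Finsupp.single_apply, if_neg]
          simpa using hg'
        · simp
      · intro b _ hb
        simp only [Finsupp.smul_apply, Finsupp.finsetSum_apply]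
        rw [Finset.sum_eq_zero, smul_zero]
        intro g' _
        rw [Finsupp.single_apply, if_neg]
        intro h
        exact hb (Sigma.mk.inj_iff.1 h).1
      · intro ha
        rw [Finsupp.notMem_support_iff.1 ha, zero_smul]
        rfl
    have hc₀ : Finsupp.linearCombination (ZMod p)
        (fun a => ((S - 1) ^ (p ^ l a - 1)) (x a)) c₀ = 0 := by
      rw [← hc, hsum, Finsupp.apply_linearCombination]
      congr 2
      ext a
      simp only [Function.comp_apply, map_sum]
      rw [← geom_sum_prime_pow, LinearMap.sum_apply]
      refine Finset.sum_congr rfl fun k hk => ?_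
      simp [Φ, orbitFamily, ZMod.val_natCast, Nat.mod_eq_of_lt (Finset.mem_range.1 hk)]
    have := linearIndependent_iff.1 hind c₀ hc₀
    rw [hsum, this, map_zero]
  have hall : ∀ (r : ℕ) c, Φ c = 0 → ((D - 1) ^ r) c = 0 → c = 0 := by
    intro r
    induction r with
    | zero => intro c _ h; simpa using h
    | succ r ih =>
      intro c hc h
      rw [pow_succ, Module.End.mul_apply] at h
      have h1 : (D - 1) c = 0 := by
        refine ih _ ?_ h
        rw [LinearMap.sub_apply, map_sub, hΦD, hc]
        simp [hc]
      exact hinv c hc (sub_eq_zero.1 h1)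
  rw [linearIndependent_iff]
  intro c hc
  exact hall (p ^ n) c hc (by rw [hDn]; rfl)


/-- The image under `(S - 1) ^ (p ^ i - 1)` of the vectors of period dividing `p ^ i`. -/
def normFil (S : Module.End (ZMod p) J) (i : ℕ) : Submodule (ZMod p) J :=
  (LinearMap.ker ((S - 1) ^ p ^ i)).map ((S - 1) ^ (p ^ i - 1))

theorem mem_normFil {S : Module.End (ZMod p) J} {i : ℕ} {y : J} :
    y ∈ normFil S i ↔ ∃ z, ((S - 1) ^ p ^ i) z = 0 ∧ ((S - 1) ^ (p ^ i - 1)) z = y := by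
  simp [normFil]

theorem normFil_antitone (S : Module.End (ZMod p) J) : Antitone (normFil S) := by
  intro i j hij y hy
  obtain ⟨z, hz, rfl⟩ := mem_normFil.1 hy
  have hpp : 0 < p := (Fact.out : p.Prime).pos
  have h1 : p ^ i ≤ p ^ j := Nat.pow_le_pow_right hpp hij
  have h0 : 0 < p ^ i := Nat.pow_pos hpp
  refine mem_normFil.2 ⟨((S - 1) ^ (p ^ j - p ^ i)) z, ?_, ?_⟩
  · rw [← Module.End.mul_apply, ← pow_add, Nat.add_sub_cancel' h1, hz]
  · rw [← Module.End.mul_apply, ← pow_add]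
    congr 2
    omega

theorem normFil_eq_bot {S : Module.End (ZMod p) J} {n i : ℕ} (hS : S ^ p ^ n = 1)
    (hi : n < i) : normFil S i = ⊥ := by
  rw [eq_bot_iff]
  intro y hy
  obtain ⟨z, -, rfl⟩ := mem_normFil.1 hy
  have h2 : p ^ n < p ^ i := Nat.pow_lt_pow_right (Fact.out : p.Prime).one_lt hi
  have h3 : (S - 1) ^ p ^ n = 0 := by
    rw [sub_one_pow_prime_pow]
    exact sub_eq_zero.2 hS
  have h4 : p ^ i - 1 = (p ^ i - 1 - p ^ n) + p ^ n := by omega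
  rw [h4, pow_add, h3, mul_zero]
  simp

theorem linearIndependent_of_filtration {k V : Type*} [Field k] [AddCommGroup V] [Module k V]
    {W : ℕ → Submodule k V} (hW : Antitone W) {N : ℕ} {ι : Fin N → Type*}
    (v : ∀ i : Fin N, ι i → V) (hv : ∀ (i : Fin N) a, v i a ∈ W i)
    (hind : ∀ i : Fin N, LinearIndependent k fun a => (W (i + 1)).mkQ (v i a)) :
    LinearIndependent k fun a : Σ i, ι i => v a.1 a.2 := by
  rw [linearIndependent_iff']
  intro s g hg
  have key : ∀ i : ℕ, ∀ a ∈ s, (a.1 : ℕ) < i → g a = 0 := by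
    intro i
    induction i with
    | zero => intro a _ h; omega
    | succ i ih =>
      intro a ha hai
      rcases Nat.lt_succ_iff_lt_or_eq.1 hai with h | h
      · exact ih a ha h
      have hinj : Set.InjOn (Sigma.mk a.1) (Sigma.mk a.1 ⁻¹' (s : Set (Σ i, ι i))) :=
        sigma_mk_injective.injOn
      have hsum : ∑ b ∈ s.preimage (Sigma.mk a.1) hinj,
          g ⟨a.1, b⟩ • (W (a.1 + 1)).mkQ (v a.1 b) = 0 := by
        rw [Finset.sum_preimage (Sigma.mk a.1) s hinj
          (fun b => g b • (W (a.1 + 1)).mkQ (v b.1 b.2))]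
        · simpa using congrArg (W (a.1 + 1)).mkQ hg
        · rintro ⟨i', b⟩ hb hb'
          rcases lt_trichotomy (i' : ℕ) (a.1 : ℕ) with h' | h' | h'
          · rw [ih _ hb (by simpa [← h] using h'), zero_smul]
          · obtain rfl : i' = a.1 := Fin.ext h'
            exact absurd ⟨b, rfl⟩ hb'
          · have : v i' b ∈ W (a.1 + 1) := hW h' (hv i' b)
            simp [this]
      exact linearIndependent_iff'.1 (hind a.1) _ (fun b => g ⟨a.1, b⟩) hsum a.2
        (by simpa using ha)
  exact fun a ha => key N a ha a.1.2

theorem span_orbitFamily_eq_top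
    (S : Module.End (ZMod p) J) {n : ℕ} (hS : S ^ p ^ n = 1)
    (hlift : ∀ i < n, ∀ y, ((S - 1) ^ (p ^ i + 1)) y = 0 →
      ∃ z, ((S - 1) ^ (p ^ (i + 1) - 1)) z = ((S - 1) ^ p ^ i) y)
    {ι : Fin (n + 1) → Type*} (x : ∀ i : Fin (n + 1), ι i → J)
    (hxS : ∀ (i : Fin (n + 1)) a, (S ^ p ^ (i : ℕ)) (x i a) = x i a)
    (hspan : ∀ i : Fin (n + 1), ∀ f ∈ normFil S i,
      ∃ y ∈ Submodule.span (ZMod p) (Set.range (x i)),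
        f - ((S - 1) ^ (p ^ (i : ℕ) - 1)) y ∈ normFil S (i + 1)) :
    Submodule.span (ZMod p) (Set.range
      (orbitFamily S (fun a : Σ i, ι i => (a.1 : ℕ)) (fun a => x a.1 a.2))) = ⊤ := by
  have hp : p.Prime := Fact.out
  set U := Submodule.span (ZMod p) (Set.range
      (orbitFamily S (fun a : Σ i, ι i => (a.1 : ℕ)) (fun a => x a.1 a.2))) with hU
  have hUS : ∀ y ∈ U, S y ∈ U := by
    intro y hy
    have : U ≤ U.comap S := by
      conv_lhs => rw [hU]
      rw [Submodule.span_le]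
      rintro _ ⟨⟨a, g⟩, rfl⟩
      have : NeZero (p ^ (a.1 : ℕ)) := ⟨pow_ne_zero _ hp.ne_zero⟩
      refine Submodule.subset_span ⟨⟨a, Multiplicative.ofAdd (Multiplicative.toAdd g + 1)⟩, ?_⟩
      exact pow_val_add_one_apply S (hxS a.1 a.2) _
    exact this hy
  have hUT : ∀ k : ℕ, ∀ y ∈ U, ((S - 1) ^ k) y ∈ U := by
    intro k
    induction k with
    | zero => exact fun y hy => hy
    | succ k ih =>
      intro y hy
      rw [pow_succ, Module.End.mul_apply]
      exact ih _ (U.sub_mem (hUS y hy) hy)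
  have hxU : ∀ i a, x i a ∈ U := by
    intro i a
    refine Submodule.subset_span ⟨⟨⟨i, a⟩, 1⟩, ?_⟩
    simp [orbitFamily]
  have hfil : ∀ j : ℕ, ∀ i, i + j = n + 1 → ∀ f ∈ normFil S i, ∀ k < p ^ i,
      ∃ u ∈ U, ((S - 1) ^ k) u = f := by
    intro j
    induction j with
    | zero =>
      intro i hi f hf k _
      rw [normFil_eq_bot hS (by omega), Submodule.mem_bot] at hf
      exact ⟨0, U.zero_mem, by simp [hf]⟩
    | succ j ih =>
      intro i hi f hf k hk
      let i' : Fin (n + 1) := ⟨i, by omega⟩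
      obtain ⟨y, hy, hmem⟩ := hspan i' f hf
      have hyU : y ∈ U := Submodule.span_le.2 (Set.range_subset_iff.2 (hxU i')) hy
      obtain ⟨u, hu, hue⟩ := ih (i + 1) (by omega) _ hmem k
        (hk.trans_le (Nat.pow_le_pow_right hp.pos (Nat.le_succ i)))
      refine ⟨u + ((S - 1) ^ (p ^ i - 1 - k)) y, U.add_mem hu (hUT _ _ hyU), ?_⟩
      rw [map_add, hue, ← Module.End.mul_apply, ← pow_add,
        show k + (p ^ i - 1 - k) = p ^ i - 1 by omega]
      abel
  have hker : ∀ k : ℕ, ∀ y, ((S - 1) ^ k) y = 0 → y ∈ U := by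
    intro k
    induction k with
    | zero =>
      intro y hy
      obtain rfl : y = 0 := hy
      exact U.zero_mem
    | succ k ih =>
      intro y hy
      have hex : ∃ i, k < p ^ i := ⟨k, Nat.lt_pow_self hp.one_lt⟩
      have hmem : ((S - 1) ^ k) y ∈ normFil S (Nat.find hex) ∧ k < p ^ (Nat.find hex) := by
        refine ⟨?_, Nat.find_spec hex⟩
        rcases h : Nat.find hex with _ | i
        · have hk := Nat.find_spec hex
          rw [h] at hk
          obtain rfl : k = 0 := by simpa using hk
          exact mem_normFil.2 ⟨y, by simpa using hy, by simp⟩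
        · have hki : p ^ i ≤ k := not_lt.1 (Nat.find_min hex (by omega))
          rcases lt_or_ge i n with hin | hin
          · obtain ⟨z, hz⟩ := hlift i hin (((S - 1) ^ (k - p ^ i)) y) (by
              rw [← Module.End.mul_apply, ← pow_add,
                show p ^ i + 1 + (k - p ^ i) = k + 1 by omega, hy])
            rw [← Module.End.mul_apply, ← pow_add, Nat.add_sub_cancel' hki] at hz
            refine mem_normFil.2 ⟨z, ?_, hz⟩
            rw [← Nat.succ_pred_eq_of_pos (Nat.pow_pos hp.pos), pow_succ', Module.End.mul_apply,
              Nat.pred_eq_sub_one, hz, ← Module.End.mul_apply, ← pow_succ', hy]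
          · have h3 : (S - 1) ^ p ^ i = 0 := by
              rw [sub_one_pow_prime_pow]
              refine sub_eq_zero.2 ?_
              rw [← Nat.add_sub_cancel' hin, pow_add, pow_mul, hS, one_pow]
            rw [← Nat.sub_add_cancel hki, pow_add, h3, mul_zero]
            exact Submodule.zero_mem _
      rcases le_or_gt (Nat.find hex) (n + 1) with hle | hlt
      · obtain ⟨u, hu, hue⟩ := hfil (n + 1 - Nat.find hex) _ (by omega) _ hmem.1 k hmem.2
        have := ih (y - u) (by rw [map_sub, hue, sub_self])
        simpa using U.add_mem this hu
      · rw [normFil_eq_bot hS (by omega), Submodule.mem_bot] at hmem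
        exact ih y hmem.1
  rw [eq_top_iff]
  intro y _
  refine hker (p ^ n) y ?_
  rw [sub_one_pow_prime_pow, hS]
  simp

theorem exists_basis_orbitFamily {J : Type w} [AddCommGroup J] [Module (ZMod p) J]
    (S : Module.End (ZMod p) J) {n : ℕ} (hS : S ^ p ^ n = 1)
    (hlift : ∀ i < n, ∀ y, ((S - 1) ^ (p ^ i + 1)) y = 0 →
      ∃ z, ((S - 1) ^ (p ^ (i + 1) - 1)) z = ((S - 1) ^ p ^ i) y) :
    ∃ (ι : Fin (n + 1) → Type w) (x : ∀ i : Fin (n + 1), ι i → J),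
      (∀ i, Cardinal.mk (ι i) =
        Module.rank (ZMod p) ((normFil S i).map (normFil S (i + 1)).mkQ)) ∧
      (∀ (i : Fin (n + 1)) a, (S ^ p ^ (i : ℕ)) (x i a) = x i a) ∧
      LinearIndependent (ZMod p)
        (orbitFamily S (fun a : Σ i, ι i => (a.1 : ℕ)) (fun a => x a.1 a.2)) ∧
      Submodule.span (ZMod p) (Set.range
        (orbitFamily S (fun a : Σ i, ι i => (a.1 : ℕ)) (fun a => x a.1 a.2))) = ⊤ := by
  obtain ⟨ι, ⟨b⟩⟩ : ∃ ι : Fin (n + 1) → Type w, Nonempty (∀ i : Fin (n + 1),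
      Module.Basis (ι i) (ZMod p) ((normFil S i).map (normFil S (i + 1)).mkQ)) :=
    ⟨_, ⟨fun _ => Module.Basis.ofVectorSpace (ZMod p) _⟩⟩
  have hex : ∀ (i : Fin (n + 1)) a, ∃ z, ((S - 1) ^ p ^ (i : ℕ)) z = 0 ∧
      (normFil S (i + 1)).mkQ (((S - 1) ^ (p ^ (i : ℕ) - 1)) z) =
        (b i a : J ⧸ normFil S (i + 1)) := by
    intro i a
    obtain ⟨f, hf, hfe⟩ := (b i a).2
    obtain ⟨z, hz, rfl⟩ := mem_normFil.1 hf
    exact ⟨z, hz, hfe⟩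
  choose x hx hxb using hex
  have hxS : ∀ (i : Fin (n + 1)) a, (S ^ p ^ (i : ℕ)) (x i a) = x i a := by
    intro i a
    have := hx i a
    rw [sub_one_pow_prime_pow] at this
    exact sub_eq_zero.1 this
  refine ⟨ι, x, fun i => (b i).mk_eq_rank'', hxS, ?_, ?_⟩
  · apply linearIndependent_orbitFamily S (n := n)
    · exact fun a => Nat.lt_succ_iff.1 a.1.2
    · exact fun a => hxS a.1 a.2
    · refine linearIndependent_of_filtration (normFil_antitone S)
        (fun i a => ((S - 1) ^ (p ^ (i : ℕ) - 1)) (x i a))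
        (fun i a => mem_normFil.2 ⟨_, hx i a, rfl⟩) fun i => ?_
      have h := (b i).linearIndependent.map' (Submodule.subtype _) (Submodule.ker_subtype _)
      have hcomp : (Submodule.subtype _ ∘ b i) =
          fun a => (normFil S (i + 1)).mkQ (((S - 1) ^ (p ^ (i : ℕ) - 1)) (x i a)) := by
        funext a
        exact (hxb i a).symm
      rwa [hcomp] at h
  · refine span_orbitFamily_eq_top S hS hlift x hxS fun i f hf => ?_
    have hsp : (⟨(normFil S (i + 1)).mkQ f, ⟨f, hf, rfl⟩⟩ :
        (normFil S i).map (normFil S (i + 1)).mkQ) ∈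
        Submodule.span (ZMod p) (Set.range (b i)) := by
      rw [(b i).span_eq]; trivial
    rw [← Finsupp.range_linearCombination] at hsp
    obtain ⟨c, hc⟩ := hsp
    have hc' := congrArg (Submodule.subtype _) hc
    rw [Finsupp.apply_linearCombination] at hc'
    have hcomp : (Submodule.subtype _ ∘ b i) =
        ((normFil S (i + 1)).mkQ ∘ₗ ((S - 1) ^ (p ^ (i : ℕ) - 1))) ∘ x i := by
      funext a
      exact (hxb i a).symm
    rw [hcomp, ← Finsupp.apply_linearCombination] at hc'
    refine ⟨Finsupp.linearCombination (ZMod p) (x i) c, ?_, ?_⟩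
    · rw [← Finsupp.range_linearCombination]
      exact ⟨c, rfl⟩
    · rw [← Submodule.Quotient.eq]
      exact hc'.symm

end LinearAlgebra

section Lifting

variable {p : ℕ} [Fact p.Prime]

theorem pow_dvd_of_linearCombination_eq {A I : Type*} [AddCommGroup A]
    (htf : ∀ a : A, p • a = 0 → a = 0) (w : I → A)
    (hw : ∀ (c : I →₀ ℤ) (a : A), Finsupp.linearCombination ℤ w c = p • a →
      ∀ i, (p : ℤ) ∣ c i) (m : ℕ) :
    ∀ (c : I →₀ ℤ) (a : A), Finsupp.linearCombination ℤ w c = p ^ m • a →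
      ∀ i, (p : ℤ) ^ m ∣ c i := by
  induction m with
  | zero => intro c a _ i; simp
  | succ m ih =>
    intro c a hc
    have hdvd := hw c (p ^ m • a) (by rw [hc, pow_succ', mul_smul])
    let c' : I →₀ ℤ := c.mapRange (fun z => z / p) (by simp)
    have hcc : c = (p : ℤ) • c' := by
      ext i
      simp [c', Int.mul_ediv_cancel' (hdvd i)]
    have hc' : Finsupp.linearCombination ℤ w c' = p ^ m • a := by
      rw [← sub_eq_zero]
      apply htf
      rw [smul_sub, sub_eq_zero, ← mul_smul, ← pow_succ', ← hc]
      conv_rhs => rw [hcc, map_smul]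
      rw [natCast_zsmul]
    intro i
    rw [hcc, Finsupp.smul_apply, smul_eq_mul, pow_succ']
    exact mul_dvd_mul_left _ (ih c' a hc' i)

theorem zmod_smul_map {A Q : Type*} [AddCommGroup A] [AddCommGroup Q] {N : ℕ} [NeZero N]
    [Module (ZMod N) Q] (π : A →+ Q) (z : ZMod N) (a : A) :
    z • π a = π ((z.val : ℤ) • a) := by
  conv_lhs => rw [← ZMod.natCast_zmod_val z, Nat.cast_smul_eq_nsmul]
  rw [natCast_zsmul, map_nsmul]

theorem intCast_smul_map {A Q : Type*} [AddCommGroup A] [AddCommGroup Q] {N : ℕ}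
    [Module (ZMod N) Q] (π : A →+ Q) (z : ℤ) (a : A) :
    (z : ZMod N) • π a = π (z • a) := by
  rw [Int.cast_smul_eq_zsmul, map_zsmul]

theorem basis_of_basis_mod_prime {A Q₁ Q I : Type*} [AddCommGroup A] [AddCommGroup Q₁]
    [AddCommGroup Q] (m : ℕ) [Module (ZMod p) Q₁] [Module (ZMod (p ^ m)) Q]
    (htf : ∀ a : A, p • a = 0 → a = 0)
    (π₁ : A →+ Q₁) (hπ₁ : ∀ a, π₁ a = 0 ↔ ∃ b, a = p • b)
    (π : A →+ Q) (hπ : ∀ a, π a = 0 ↔ ∃ b, a = p ^ m • b) (hsurj : Function.Surjective π)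
    (w : I → A) (hind : LinearIndependent (ZMod p) (π₁ ∘ w))
    (hspan : Submodule.span (ZMod p) (Set.range (π₁ ∘ w)) = ⊤) :
    LinearIndependent (ZMod (p ^ m)) (π ∘ w) ∧
      Submodule.span (ZMod (p ^ m)) (Set.range (π ∘ w)) = ⊤ := by
  have hne : NeZero (p ^ m) := ⟨pow_ne_zero _ (Fact.out : p.Prime).ne_zero⟩
  constructor
  · have hw : ∀ (c : I →₀ ℤ) (a : A), Finsupp.linearCombination ℤ w c = p • a →
        ∀ i, (p : ℤ) ∣ c i := by
      intro c a hc i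
      have h0 : Finsupp.linearCombination (ZMod p) (π₁ ∘ w)
          (c.mapRange (Int.cast : ℤ → ZMod p) Int.cast_zero) = 0 := by
        rw [← (hπ₁ _).2 ⟨a, hc⟩, Finsupp.linearCombination_apply, Finsupp.linearCombination_apply,
          Finsupp.sum_mapRange_index (by simp), map_finsuppSum]
        simp only [Function.comp_apply, intCast_smul_map]
      have := DFunLike.congr_fun (linearIndependent_iff.1 hind _ h0) i
      rw [Finsupp.mapRange_apply] at this
      exact (ZMod.intCast_zmod_eq_zero_iff_dvd _ _).1 this
    rw [linearIndependent_iff]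
    intro c hc
    have h0 : π (Finsupp.linearCombination ℤ w
        (c.mapRange (fun z : ZMod (p ^ m) => (z.val : ℤ)) (by simp))) = 0 := by
      rw [← hc, Finsupp.linearCombination_apply, Finsupp.linearCombination_apply,
        Finsupp.sum_mapRange_index (by simp), map_finsuppSum]
      simp only [Function.comp_apply, zmod_smul_map]
    obtain ⟨a, ha⟩ := (hπ _).1 h0
    ext i
    have := pow_dvd_of_linearCombination_eq htf w hw m _ a ha i
    rw [Finsupp.mapRange_apply] at this
    have h2 : p ^ m ∣ (c i).val := by exact_mod_cast this
    rw [← ZMod.natCast_eq_zero_iff, ZMod.natCast_zmod_val] at h2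
    simpa using h2
  · have h1 : ∀ a : A, ∃ v ∈ Submodule.span ℤ (Set.range w), ∃ b, a = v + p • b := by
      intro a
      have ha : π₁ a ∈ Submodule.span (ZMod p) (Set.range (π₁ ∘ w)) := by rw [hspan]; trivial
      rw [← Finsupp.range_linearCombination] at ha
      obtain ⟨c, hc⟩ := ha
      let c' : I →₀ ℤ := c.mapRange (fun z : ZMod p => (z.val : ℤ)) (by simp)
      have hc' : π₁ (Finsupp.linearCombination ℤ w c') = π₁ a := by
        rw [← hc, Finsupp.linearCombination_apply, Finsupp.linearCombination_apply,
          Finsupp.sum_mapRange_index (by simp), map_finsuppSum]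
        simp only [Function.comp_apply, zmod_smul_map]
      obtain ⟨b, hb⟩ := (hπ₁ (a - Finsupp.linearCombination ℤ w c')).1 (by
        rw [map_sub, hc', sub_self])
      refine ⟨Finsupp.linearCombination ℤ w c', ?_, b, ?_⟩
      · rw [← Finsupp.range_linearCombination]
        exact ⟨c', rfl⟩
      · rw [← hb]; abel
    have h2 : ∀ (k : ℕ) (a : A),
        ∃ v ∈ Submodule.span ℤ (Set.range w), ∃ b, a = v + p ^ k • b := by
      intro k
      induction k with
      | zero => exact fun a => ⟨0, Submodule.zero_mem _, a, by simp⟩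
      | succ k ih =>
        intro a
        obtain ⟨v, hv, b, rfl⟩ := ih a
        obtain ⟨v', hv', b', rfl⟩ := h1 b
        refine ⟨v + p ^ k • v', Submodule.add_mem _ hv (Submodule.smul_of_tower_mem _ _ hv'),
          b', ?_⟩
        rw [smul_add, pow_succ, mul_smul, add_assoc]
    rw [eq_top_iff]
    rintro y -
    obtain ⟨a, rfl⟩ := hsurj y
    obtain ⟨v, hv, b, rfl⟩ := h2 m a
    rw [map_add, (hπ _).2 ⟨b, rfl⟩, add_zero]
    induction hv using Submodule.span_induction with
    | mem x hx =>
      obtain ⟨i, rfl⟩ := hx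
      exact Submodule.subset_span ⟨i, rfl⟩
    | zero => simp
    | add x y _ _ hx hy => rw [map_add]; exact Submodule.add_mem _ hx hy
    | smul z x _ hx => rw [← intCast_smul_map (N := p ^ m)]; exact Submodule.smul_mem _ _ hx

theorem fpdim_eq_rank_of_injective {Q V : Type w} [CommGroup Q] [AddCommGroup V]
    [Module (ZMod p) V] (φ : Additive Q →+ V) (hφ : Function.Injective φ)
    (W : Submodule (ZMod p) V) (hW : ∀ v, v ∈ W ↔ ∃ q, φ q = v) :
    fpdim p Q = Module.rank (ZMod p) W := by
  let l : TensorProduct ℤ (ZMod p) (Additive Q) →ₗ[ZMod p] V :=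
    LinearMap.liftBaseChange (ZMod p) φ.toIntLinearMap
  have hl : ∀ q : Additive Q, l (1 ⊗ₜ[ℤ] q) = φ q := fun q => by simp [l]
  have hsurj : ∀ z : TensorProduct ℤ (ZMod p) (Additive Q), ∃ q : Additive Q, z = 1 ⊗ₜ[ℤ] q := by
    intro z
    induction z using TensorProduct.induction_on with
    | zero => exact ⟨0, by simp⟩
    | tmul a q =>
      refine ⟨(a.val : ℤ) • q, ?_⟩
      rw [← TensorProduct.smul_tmul]
      simp
    | add x y hx hy =>
      obtain ⟨q, rfl⟩ := hx
      obtain ⟨q', rfl⟩ := hy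
      exact ⟨q + q', by rw [TensorProduct.tmul_add]⟩
  have hinj : Function.Injective l := by
    rw [injective_iff_map_eq_zero]
    intro z hz
    obtain ⟨q, rfl⟩ := hsurj z
    rw [hl, map_eq_zero_iff φ hφ] at hz
    rw [hz, TensorProduct.tmul_zero]
  have hrange : LinearMap.range l = W := by
    ext v
    rw [hW]
    constructor
    · rintro ⟨z, rfl⟩
      obtain ⟨q, rfl⟩ := hsurj z
      exact ⟨q, (hl q).symm⟩
    · rintro ⟨q, rfl⟩
      exact ⟨_, hl q⟩
  rw [← hrange]
  exact (LinearEquiv.ofInjective l hinj).rank_eq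

theorem fpdim_quotient_eq_rank {U V : Type w} [CommGroup U] [AddCommGroup V]
    [Module (ZMod p) V] (π : Additive U →+ V) (N N' : Subgroup U) (W W' : Submodule (ZMod p) V)
    (hN : ∀ x ∈ N, π (Additive.ofMul x) ∈ W)
    (hW : ∀ y ∈ W, ∃ x ∈ N, π (Additive.ofMul x) = y)
    (hN' : ∀ x ∈ N', π (Additive.ofMul x) ∈ W')
    (hW' : ∀ x ∈ N, π (Additive.ofMul x) ∈ W' → x ∈ N') :
    fpdim p (N ⧸ N'.subgroupOf N) = Module.rank (ZMod p) (W.map W'.mkQ) := by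
  let ψ : N →* Multiplicative (V ⧸ W') :=
    (AddMonoidHom.toMultiplicative (W'.mkQ.toAddMonoidHom.comp π)).comp
      ((MulEquiv.multiplicativeAdditive U).symm.toMonoidHom.comp N.subtype)
  have hψ : ∀ x : N, ψ x = Multiplicative.ofAdd (W'.mkQ (π (Additive.ofMul (x : U)))) :=
    fun x => rfl
  have hker : ∀ x : N, ψ x = 1 ↔ x ∈ N'.subgroupOf N := by
    intro x
    rw [hψ, ofAdd_eq_one, Submodule.mkQ_apply, Submodule.Quotient.mk_eq_zero,
      Subgroup.mem_subgroupOf]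
    exact ⟨hW' x x.2, hN' x⟩
  let ψ' : (N ⧸ N'.subgroupOf N) →* Multiplicative (V ⧸ W') :=
    QuotientGroup.lift _ ψ fun x hx => (hker x).2 hx
  have hψ' : Function.Injective ψ' := by
    rw [injective_iff_map_eq_one]
    intro q hq
    induction q using QuotientGroup.induction_on with
    | H x => exact (QuotientGroup.eq_one_iff x).2 ((hker x).1 hq)
  refine fpdim_eq_rank_of_injective (MonoidHom.toAdditiveLeft ψ') hψ' _ fun v => ?_
  constructor
  · rintro ⟨y, hy, rfl⟩
    obtain ⟨x, hx, rfl⟩ := hW y hy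
    exact ⟨Additive.ofMul (QuotientGroup.mk ⟨x, hx⟩), rfl⟩
  · rintro ⟨q, rfl⟩
    obtain ⟨x, hx⟩ := QuotientGroup.mk_surjective q.toMul
    obtain rfl : q = Additive.ofMul (QuotientGroup.mk x) := by rw [hx]; rfl
    exact ⟨_, hN x x.2, rfl⟩

end Lifting

section ModPrime

theorem geom_sum_mul_geom_sum_pow {R : Type*} [Ring R] (s : R) (p q : ℕ) :
    (∑ k ∈ Finset.range p, s ^ (q * k)) * ∑ k ∈ Finset.range q, s ^ k =
      ∑ k ∈ Finset.range (q * p), s ^ k := by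
  induction p with
  | zero => simp
  | succ p ih =>
    rw [Finset.sum_range_succ, add_mul, ih, Nat.mul_succ, Finset.sum_range_add, Finset.mul_sum]
    simp [pow_add]

variable {p n : ℕ} {A J : Type*} [AddCommGroup A] {s : Module.End ℤ A}

/-- `A` has no `p`-torsion, and Hilbert 90 holds in `A` for the subgroups of the cyclic group of
order `p ^ n` generated by `s` and for the successive layers of its fixed points. -/
structure HilbertNinety (p n : ℕ) (s : Module.End ℤ A) : Prop where
  torsion_free : ∀ a : A, p • a = 0 → a = 0
  pow_eq_one : s ^ p ^ n = 1
  top : ∀ j ≤ n, ∀ b, (∑ k ∈ Finset.range (p ^ (n - j)), s ^ (p ^ j * k)) b = 0 →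
    ∃ c, b = (s ^ p ^ j) c - c
  layer : ∀ i < n, ∀ b, (s ^ p ^ (i + 1)) b = b →
    (∑ k ∈ Finset.range p, s ^ (p ^ i * k)) b = 0 →
    ∃ c, (s ^ p ^ (i + 1)) c = c ∧ b = (s ^ p ^ i) c - c

theorem HilbertNinety.nsmul_injective (h : HilbertNinety p n s) {a b : A}
    (hab : p • a = p • b) : a = b := by
  rw [← sub_eq_zero]
  exact h.torsion_free _ (by rw [smul_sub, hab, sub_self])

theorem map_pow_apply {R : Type*} [Semiring R] [AddCommGroup J] [Module R J]
    {S : Module.End R J} {π : A →+ J} (hS : ∀ a, S (π a) = π (s a)) (k : ℕ) (a : A) :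
    (S ^ k) (π a) = π ((s ^ k) a) := by
  induction k with
  | zero => simp
  | succ k ih => rw [pow_succ', pow_succ', Module.End.mul_apply, Module.End.mul_apply, ih, hS]

variable [Fact p.Prime] [AddCommGroup J] [Module (ZMod p) J] {S : Module.End (ZMod p) J}
  {π : A →+ J}

theorem map_geom_sum_apply (hS : ∀ a, S (π a) = π (s a)) (i : ℕ) (a : A) :
    π ((∑ k ∈ Finset.range (p ^ i), s ^ k) a) = ((S - 1) ^ (p ^ i - 1)) (π a) := by
  rw [← geom_sum_prime_pow]
  simp [map_pow_apply hS]

theorem HilbertNinety.exists_fixed_lift (h : HilbertNinety p n s)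
    (hS : ∀ a, S (π a) = π (s a)) (hπ : ∀ a, π a = 0 ↔ ∃ b, a = p • b)
    (hsurj : Function.Surjective π) {j : ℕ} (hj : j ≤ n) {y : J} (hy : (S ^ p ^ j) y = y) :
    ∃ a, (s ^ p ^ j) a = a ∧ π a = y := by
  obtain ⟨a, rfl⟩ := hsurj y
  rw [map_pow_apply hS] at hy
  obtain ⟨b, hb⟩ := (hπ ((s ^ p ^ j) a - a)).1 (by rw [map_sub, hy, sub_self])
  have hN : (∑ k ∈ Finset.range (p ^ (n - j)), s ^ (p ^ j * k)) * (s ^ p ^ j - 1) = 0 := by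
    simp_rw [pow_mul]
    rw [geom_sum_mul, ← pow_mul, ← pow_add, Nat.add_sub_cancel' hj]
    exact sub_eq_zero.2 h.pow_eq_one
  obtain ⟨c, rfl⟩ := h.top j hj b (h.torsion_free _ (by
    rw [← map_nsmul, ← hb]
    exact LinearMap.congr_fun hN a))
  refine ⟨a - p • c, ?_, ?_⟩
  · rw [map_sub, map_nsmul, eq_add_of_sub_eq hb, smul_sub]
    abel
  · rw [map_sub, (hπ _).2 ⟨c, rfl⟩, sub_zero]

theorem HilbertNinety.exists_norm_lift (h : HilbertNinety p n s)
    (hS : ∀ a, S (π a) = π (s a)) (hπ : ∀ a, π a = 0 ↔ ∃ b, a = p • b)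
    (hsurj : Function.Surjective π) {i : ℕ} (hi : i < n) {y : J}
    (hy : ((S - 1) ^ (p ^ i + 1)) y = 0) :
    ∃ z, ((S - 1) ^ (p ^ (i + 1) - 1)) z = ((S - 1) ^ p ^ i) y := by
  have hp : p.Prime := Fact.out
  have hle : p ^ i + 1 ≤ p ^ (i + 1) := Nat.pow_lt_pow_right hp.one_lt (Nat.lt_succ_self i)
  have hy' : (S ^ p ^ (i + 1)) y = y := by
    rw [← sub_eq_zero]
    change (S ^ p ^ (i + 1) - 1) y = 0
    rw [← sub_one_pow_prime_pow, ← Nat.sub_add_cancel hle, pow_add, Module.End.mul_apply, hy,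
      map_zero]
  obtain ⟨a, ha, rfl⟩ := h.exists_fixed_lift hS hπ hsurj hi hy'
  have hf : (S ^ p ^ 0) (((S - 1) ^ p ^ i) (π a)) = ((S - 1) ^ p ^ i) (π a) := by
    rw [pow_succ', Module.End.mul_apply] at hy
    rw [pow_zero, pow_one]
    exact sub_eq_zero.1 hy
  obtain ⟨f, hf, hfe⟩ := h.exists_fixed_lift hS hπ hsurj (Nat.zero_le n) hf
  rw [pow_zero, pow_one] at hf
  rw [← hfe]
  rw [sub_one_pow_prime_pow, LinearMap.sub_apply, map_pow_apply hS, Module.End.one_apply,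
    ← map_sub] at hfe
  obtain ⟨b, hb⟩ := (hπ (f - ((s ^ p ^ i) a - a))).1 (by rw [map_sub, hfe, sub_self])
  have hfs : ∀ k : ℕ, (s ^ k) f = f := by
    intro k
    induction k with
    | zero => rfl
    | succ k ih => rw [pow_succ, Module.End.mul_apply, hf, ih]
  set N := ∑ k ∈ Finset.range p, s ^ (p ^ i * k) with hN
  have hNs : N * (s ^ p ^ i - 1) = s ^ p ^ (i + 1) - 1 := by
    rw [hN]
    simp_rw [pow_mul]
    rw [geom_sum_mul, ← pow_mul, ← pow_succ]
  have hNb : N b = f := by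
    apply h.nsmul_injective
    rw [← map_nsmul, ← hb, map_sub]
    have h1 : N ((s ^ p ^ i) a - a) = 0 := by
      have := LinearMap.congr_fun hNs a
      simpa [ha] using this
    rw [h1, hN]
    simp [hfs]
  have hbfix : (s ^ p ^ (i + 1)) b = b := by
    apply h.nsmul_injective
    rw [← map_nsmul, ← hb, map_sub, map_sub, hfs, ha, ← Module.End.mul_apply,
      (Commute.pow_pow_self s _ _).eq, Module.End.mul_apply, ha]
  have hNcomm : N * s = s * N := by
    rw [hN, Finset.sum_mul, Finset.mul_sum]
    exact Finset.sum_congr rfl fun k _ => (Commute.pow_self s _).eq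
  obtain ⟨c, hc, hbc⟩ := h.layer i hi (s b - b) (by
    rw [map_sub, hbfix, ← Module.End.mul_apply, (Commute.pow_self s _).eq, Module.End.mul_apply,
      hbfix]) (by
    rw [← hN, map_sub, ← Module.End.mul_apply, hNcomm, Module.End.mul_apply, hNb, hf, sub_self])
  set g := b - (∑ k ∈ Finset.range (p ^ i), s ^ k) c with hg
  have hgs : s g = g := by
    have h1 : s ((∑ k ∈ Finset.range (p ^ i), s ^ k) c) -
        (∑ k ∈ Finset.range (p ^ i), s ^ k) c = (s ^ p ^ i) c - c :=
      LinearMap.congr_fun (mul_geom_sum s (p ^ i)) c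
    rw [← hbc] at h1
    rw [hg, map_sub, sub_eq_sub_iff_sub_eq_sub, h1]
  have hgk : ∀ k : ℕ, (s ^ k) g = g := by
    intro k
    induction k with
    | zero => rfl
    | succ k ih => rw [pow_succ, Module.End.mul_apply, hgs, ih]
  refine ⟨π c, ?_⟩
  rw [← map_geom_sum_apply hS, pow_succ, ← geom_sum_mul_geom_sum_pow, ← hN, Module.End.mul_apply,
    show (∑ k ∈ Finset.range (p ^ i), s ^ k) c = b - g by rw [hg]; abel, map_sub, hNb, map_sub,
    (hπ (N g)).2 ⟨g, ?_⟩, sub_zero]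
  rw [hN]
  simp [hgk]

theorem HilbertNinety.mem_normFil_iff (h : HilbertNinety p n s)
    (hS : ∀ a, S (π a) = π (s a)) (hπ : ∀ a, π a = 0 ↔ ∃ b, a = p • b)
    (hsurj : Function.Surjective π) {i : ℕ} (hi : i ≤ n) {y : J} :
    y ∈ normFil S i ↔
      ∃ a, (s ^ p ^ i) a = a ∧ π ((∑ k ∈ Finset.range (p ^ i), s ^ k) a) = y := by
  rw [mem_normFil]
  constructor
  · rintro ⟨z, hz, rfl⟩
    rw [sub_one_pow_prime_pow] at hz
    obtain ⟨a, ha, rfl⟩ := h.exists_fixed_lift hS hπ hsurj hi (sub_eq_zero.1 hz)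
    exact ⟨a, ha, map_geom_sum_apply hS i a⟩
  · rintro ⟨a, ha, rfl⟩
    refine ⟨π a, ?_, (map_geom_sum_apply hS i a).symm⟩
    rw [sub_one_pow_prime_pow]
    refine sub_eq_zero.2 ?_
    rw [map_pow_apply hS, ha]
    rfl

end ModPrime

section Units

variable {F K : Type*} [Field F] [Field K] [Algebra F K] {p n : ℕ} {σ : K ≃ₐ[F] K}

theorem umap_mul (τ ρ : K ≃ₐ[F] K) (x : Kˣ) : umap (τ * ρ) x = umap τ (umap ρ x) := rfl

theorem umap_injective (τ : K ≃ₐ[F] K) : Function.Injective (umap τ) :=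
  Units.map_injective τ.injective

theorem mem_KiU {i : ℕ} {x : Kˣ} : x ∈ KiU p σ i ↔ umap (σ ^ p ^ i) x = x := by
  rw [KiU, MonoidHom.mem_ker, MonoidHom.div_apply, div_eq_one, MonoidHom.id_apply]

theorem umap_pow_comm (a b : ℕ) (x : Kˣ) :
    umap (σ ^ a) (umap (σ ^ b) x) = umap (σ ^ b) (umap (σ ^ a) x) := by
  rw [← umap_mul, ← umap_mul, (Commute.pow_pow_self σ a b).eq]

theorem umap_pow_mem_KiU {i : ℕ} {x : Kˣ} (hx : x ∈ KiU p σ i) (k : ℕ) :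
    umap (σ ^ k) x ∈ KiU p σ i := by
  rw [mem_KiU] at hx ⊢
  rw [umap_pow_comm, hx]

theorem exists_div_eq_of_prod_eq_one {i r N : ℕ} (hN : 0 < N)
    (hfix : ∀ y ∈ KiU p σ i, umap (σ ^ (r * N)) y = y)
    (hdist : ∀ k, 0 < k → k < N → ∃ y ∈ KiU p σ i, umap (σ ^ (r * k)) y ≠ y)
    {x : Kˣ} (hx : x ∈ KiU p σ i) (hprod : ∏ k ∈ Finset.range N, umap (σ ^ (r * k)) x = 1) :
    ∃ c ∈ KiU p σ i, x = umap (σ ^ r) c / c := by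
  let a : ℕ → Kˣ := fun k => ∏ j ∈ Finset.range k, umap (σ ^ (r * j)) x
  have ha : ∀ k, a k ∈ KiU p σ i := fun k =>
    Subgroup.prod_mem _ fun j _ => umap_pow_mem_KiU hx _
  have hsucc : ∀ k, x * umap (σ ^ r) (a k) = a (k + 1) := by
    intro k
    simp only [a]
    rw [Finset.prod_range_succ', map_prod, mul_zero, pow_zero, mul_comm]
    congr 1
    refine Finset.prod_congr rfl fun j _ => ?_
    rw [← umap_mul, ← pow_add, Nat.mul_succ, add_comm]
  let χ : Fin N → (KiU p σ i →* K) := fun k =>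
    (Units.coeHom K).comp ((umap (σ ^ (r * k))).comp (KiU p σ i).subtype)
  have hχ : Function.Injective χ := by
    have key : ∀ j k : Fin N, j < k → χ j ≠ χ k := by
      intro j k hjk h
      obtain ⟨y, hy, hne⟩ := hdist (k - j) (Nat.sub_pos_of_lt hjk) (by omega)
      refine hne (umap_injective (σ ^ (r * j)) ?_)
      rw [← umap_mul, ← pow_add, ← Nat.mul_add, Nat.add_sub_cancel' (le_of_lt hjk)]
      exact (Units.ext (DFunLike.congr_fun h ⟨y, hy⟩)).symm
    intro j k h
    rcases lt_trichotomy j k with h' | h' | h'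
    · exact absurd h (key j k h')
    · exact h'
    · exact absurd h.symm (key k j h')
  have hind := (linearIndependent_monoidHom (KiU p σ i) K).comp χ hχ
  obtain ⟨y, hy⟩ : ∃ y : KiU p σ i, ∑ k : Fin N, (a k : K) * χ k y ≠ 0 := by
    by_contra! h
    have h1 := Fintype.linearIndependent_iff.1 hind (fun k => (a k : K)) (by
      funext y
      simpa using h y) ⟨0, hN⟩
    exact (a 0).ne_zero h1
  let t : ℕ → K := fun k => (a k : K) * (umap (σ ^ (r * k)) (y : Kˣ) : K)
  have ht : ∑ k ∈ Finset.range N, t k ≠ 0 := by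
    rw [Finset.sum_range]
    exact hy
  let c := Units.mk0 _ ht
  have hc : c ∈ KiU p σ i := by
    rw [mem_KiU]
    ext
    change (σ ^ p ^ i) (∑ k ∈ Finset.range N, t k) = ∑ k ∈ Finset.range N, t k
    rw [map_sum]
    refine Finset.sum_congr rfl fun k _ => ?_
    have h1 := mem_KiU.1 (ha k)
    have h2 := mem_KiU.1 (umap_pow_mem_KiU y.2 (r * k))
    rw [map_mul]
    exact congrArg₂ (· * ·) (congrArg Units.val h1) (congrArg Units.val h2)
  have hxc : x * umap (σ ^ r) c = c := by
    ext
    change (x : K) * (σ ^ r) (∑ k ∈ Finset.range N, t k) = ∑ k ∈ Finset.range N, t k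
    have hstep : ∀ k, (x : K) * (σ ^ r) (t k) = t (k + 1) := by
      intro k
      have h1 := congrArg Units.val (hsucc k)
      have h2 : umap (σ ^ r) (umap (σ ^ (r * k)) (y : Kˣ)) = umap (σ ^ (r * (k + 1))) y := by
        rw [← umap_mul, ← pow_add, Nat.mul_succ, add_comm]
      rw [map_mul, ← mul_assoc]
      exact congrArg₂ (· * ·) h1 (congrArg Units.val h2)
    have hends : t N = t 0 := by
      have h1 : a N = a 0 := by
        simp only [a, hprod, Finset.range_zero, Finset.prod_empty]
      simp only [t]
      rw [hfix _ y.2, h1, mul_zero, pow_zero]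
      rfl
    rw [map_sum, Finset.mul_sum, Finset.sum_congr rfl fun k _ => hstep k]
    have h1 := Finset.sum_range_succ t N
    rw [Finset.sum_range_succ', hends] at h1
    exact add_right_cancel h1
  refine ⟨c⁻¹, inv_mem hc, ?_⟩
  rw [map_inv, eq_div_iff_mul_eq', ← div_eq_mul_inv, div_eq_iff_eq_mul, eq_inv_mul_iff_mul_eq,
    mul_comm, hxc]

theorem mem_Funits_iff [FiniteDimensional F K] [IsGalois F K]
    (hgen : ∀ τ : K ≃ₐ[F] K, τ ∈ Subgroup.zpowers σ) {x : Kˣ} :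
    x ∈ Funits F ↔ umap σ x = x := by
  constructor
  · rintro ⟨y, rfl⟩
    ext
    exact σ.commutes y
  · intro h
    have hσ : σ ∈ MulAction.stabilizer (K ≃ₐ[F] K) (x : K) := congrArg Units.val h
    obtain ⟨y, hy⟩ := IntermediateField.mem_bot.1 ((IsGalois.mem_bot_iff_fixed (F := F) (x : K)).2
      fun τ => (Subgroup.zpowers_le.2 hσ) (hgen τ))
    refine ⟨Units.mk0 y fun h0 => x.ne_zero ?_, Units.ext hy⟩
    rw [← hy, h0, map_zero]

theorem eq_one_of_pow_eq_one [FiniteDimensional F K] [IsGalois F K] (hp : p.Prime)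
    (hσ : σ ^ p ^ n = 1) (hgen : ∀ τ : K ≃ₐ[F] K, τ ∈ Subgroup.zpowers σ)
    (hnoroot : ∀ x : F, ¬ IsPrimitiveRoot x p) {x : Kˣ} (hx : x ^ p = 1) : x = 1 := by
  have : Fact p.Prime := ⟨hp⟩
  by_contra hne
  have hprim : IsPrimitiveRoot x p := orderOf_eq_prime hx hne ▸ IsPrimitiveRoot.orderOf x
  have hne0 : NeZero p := ⟨hp.ne_zero⟩
  obtain ⟨a, -, ha⟩ := hprim.eq_pow_of_mem_rootsOfUnity (ξ := umap σ x) (by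
    rw [mem_rootsOfUnity, ← map_pow, hx, map_one])
  have hiter : ∀ k : ℕ, umap (σ ^ k) x = x ^ a ^ k := by
    intro k
    induction k with
    | zero => rw [pow_zero, pow_zero, pow_one]; rfl
    | succ k ih => rw [pow_succ, umap_mul, ← ha, map_pow, ih, ← pow_mul, pow_succ]
  have h1 : x ^ a ^ p ^ n = x ^ 1 := by rw [← hiter, hσ, pow_one]; rfl
  rw [pow_eq_pow_iff_modEq, ← hprim.eq_orderOf, ← ZMod.natCast_eq_natCast_iff, Nat.cast_pow,
    ZMod.pow_card_pow, ZMod.natCast_eq_natCast_iff, hprim.eq_orderOf,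
    ← pow_eq_pow_iff_modEq, ha, pow_one] at h1
  obtain ⟨y, rfl⟩ := (mem_Funits_iff hgen).2 h1
  refine hnoroot y ?_
  have h2 : IsPrimitiveRoot ((algebraMap F K) y) p := IsPrimitiveRoot.coe_units_iff.2 hprim
  exact h2.of_map_of_injective (algebraMap F K).injective

/-- The action of `σ` on the additive group `Additive Kˣ`. -/
def unitsEnd (σ : K ≃ₐ[F] K) : Module.End ℤ (Additive Kˣ) :=
  (MonoidHom.toAdditive (umap σ)).toIntLinearMap

theorem unitsEnd_pow_apply (k : ℕ) (x : Kˣ) :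
    (unitsEnd σ ^ k) (Additive.ofMul x) = Additive.ofMul (umap (σ ^ k) x) := by
  induction k with
  | zero => rfl
  | succ k ih =>
    rw [pow_succ', pow_succ', Module.End.mul_apply, ih, umap_mul]
    rfl

theorem unitsEnd_sum_apply (N : ℕ) (f : ℕ → ℕ) (x : Kˣ) :
    (∑ k ∈ Finset.range N, unitsEnd σ ^ f k) (Additive.ofMul x) =
      Additive.ofMul (∏ k ∈ Finset.range N, umap (σ ^ f k) x) := by
  rw [LinearMap.sum_apply, ofMul_prod]
  exact Finset.sum_congr rfl fun k _ => unitsEnd_pow_apply _ _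

theorem hilbertNinety_unitsEnd [FiniteDimensional F K] [IsGalois F K] (hp : p.Prime)
    (horder : orderOf σ = p ^ n) (hgen : ∀ τ : K ≃ₐ[F] K, τ ∈ Subgroup.zpowers σ)
    (hnoroot : ∀ x : F, ¬ IsPrimitiveRoot x p) : HilbertNinety p n (unitsEnd σ) := by
  have hσ : σ ^ p ^ n = 1 := horder ▸ pow_orderOf_eq_one σ
  have htf : ∀ x : Kˣ, x ^ p = 1 → x = 1 := fun x hx =>
    eq_one_of_pow_eq_one hp hσ hgen hnoroot hx
  refine ⟨fun a ha => htf a.toMul ha, ?_, ?_, ?_⟩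
  · ext x : 1
    change (unitsEnd σ ^ p ^ n) (Additive.ofMul x.toMul) = x
    rw [unitsEnd_pow_apply, hσ]
    rfl
  · intro j hj b hb
    have hall : ∀ y : Kˣ, y ∈ KiU p σ n := fun y => by
      rw [mem_KiU, hσ]
      rfl
    have hmul : p ^ j * p ^ (n - j) = p ^ n := by rw [← pow_add, Nat.add_sub_cancel' hj]
    obtain ⟨c, -, hc⟩ := exists_div_eq_of_prod_eq_one (i := n) (r := p ^ j) (N := p ^ (n - j))
      (x := b.toMul) (pow_pos hp.pos _)
      (fun y _ => by rw [hmul, hσ]; rfl)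
      (fun k hk hkN => by
        by_contra! h
        refine pow_ne_one_of_lt_orderOf (x := σ) (n := p ^ j * k)
          (mul_pos (pow_pos hp.pos _) hk).ne' ?_ ?_
        · rw [horder, ← hmul]
          exact Nat.mul_lt_mul_of_pos_left hkN (pow_pos hp.pos _)
        · ext z
          by_cases hz : z = 0
          · rw [hz, map_zero, map_zero]
          · exact congrArg Units.val (h (Units.mk0 z hz) (hall _)))
      (hall _) (by
        have := unitsEnd_sum_apply (σ := σ) (p ^ (n - j)) (fun k => p ^ j * k) b.toMul
        rw [ofMul_toMul, hb] at this
        exact this.symm)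
    refine ⟨Additive.ofMul c, ?_⟩
    rw [unitsEnd_pow_apply]
    exact hc
  · intro i hi b hb hsum
    have hbm : b.toMul ∈ KiU p σ (i + 1) := by
      rw [mem_KiU]
      exact (unitsEnd_pow_apply _ _).symm.trans hb
    have hprod : ∏ k ∈ Finset.range p, umap (σ ^ (p ^ i * k)) b.toMul = 1 := by
      have := unitsEnd_sum_apply (σ := σ) p (fun k => p ^ i * k) b.toMul
      rw [ofMul_toMul, hsum] at this
      exact this.symm
    by_cases htriv : ∀ y ∈ KiU p σ (i + 1), umap (σ ^ p ^ i) y = y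
    · have hiter : ∀ k, umap (σ ^ (p ^ i * k)) b.toMul = b.toMul := by
        intro k
        induction k with
        | zero => rfl
        | succ k ih => rw [Nat.mul_succ, pow_add, umap_mul, htriv _ hbm, ih]
      rw [Finset.prod_congr rfl fun k _ => hiter k, Finset.prod_const, Finset.card_range] at hprod
      have hb0 : b = 0 := htf _ hprod
      exact ⟨0, map_zero _, by rw [hb0, map_zero, sub_zero]⟩
    · push Not at htriv
      obtain ⟨y, hy, hne⟩ := htriv
      have hper : ∀ k, umap (σ ^ (p ^ i * k)) y = (umap (σ ^ p ^ i))^[k] y := by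
        intro k
        induction k with
        | zero => rfl
        | succ k ih =>
          rw [Function.iterate_succ_apply', ← ih, Nat.mul_succ, add_comm, pow_add, umap_mul]
      obtain ⟨c, hc, hbc⟩ := exists_div_eq_of_prod_eq_one (i := i + 1) (r := p ^ i) (N := p)
        (x := b.toMul) hp.pos
        (fun z hz => by rw [← pow_succ]; exact mem_KiU.1 hz)
        (fun k hk hkp => ⟨y, hy, fun h => hne (by
          have h1 : Function.IsPeriodicPt (umap (σ ^ p ^ i)) k y := (hper k).symm.trans h
          have h2 : Function.IsPeriodicPt (umap (σ ^ p ^ i)) p y := by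
            refine (hper p).symm.trans ?_
            rw [← pow_succ]
            exact mem_KiU.1 hy
          have h3 := h2.gcd h1
          rwa [(Nat.coprime_of_lt_prime hk.ne' hkp hp).gcd_eq_one] at h3)⟩)
        hbm hprod
      refine ⟨Additive.ofMul c, ?_, ?_⟩
      · rw [unitsEnd_pow_apply, mem_KiU.1 hc]
      · rw [unitsEnd_pow_apply]
        exact hbc

end Units

section Decomposition

open Module

theorem gen_smul_single (p m i : ℕ) (g : Multiplicative (ZMod (p ^ i))) :
    gen p m i • (MonoidAlgebra.single g 1 : CycGR p m i) =
      MonoidAlgebra.single (Multiplicative.ofAdd (Multiplicative.toAdd g + 1)) 1 := by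
  rw [gen, MonoidAlgebra.of_apply, smul_eq_mul, MonoidAlgebra.single_mul_single, one_mul, add_comm]
  rfl

theorem exists_equiv_of_basis {p : ℕ} [Fact p.Prime] {m n : ℕ} {Q : Type*} [AddCommGroup Q]
    [Module (ZMod (p ^ m)) Q] (T : Module.End (ZMod (p ^ m)) Q) {ι : Fin (n + 1) → Type*}
    (y : ∀ i, ι i → Q) (hy : ∀ (i : Fin (n + 1)) a, (T ^ p ^ (i : ℕ)) (y i a) = y i a)
    (hind : LinearIndependent (ZMod (p ^ m))
      fun j : Σ a : Σ i, ι i, Multiplicative (ZMod (p ^ (a.1 : ℕ))) =>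
        (T ^ (Multiplicative.toAdd j.2).val) (y j.1.1 j.1.2))
    (hspan : Submodule.span (ZMod (p ^ m)) (Set.range
      fun j : Σ a : Σ i, ι i, Multiplicative (ZMod (p ^ (a.1 : ℕ))) =>
        (T ^ (Multiplicative.toAdd j.2).val) (y j.1.1 j.1.2)) = ⊤) :
    ∃ e : Q ≃+ ((i : Fin (n + 1)) → (ι i →₀ CycGR p m (i : ℕ))),
      ∀ q, e (T q) = fun i : Fin (n + 1) => gen p m (i : ℕ) • e q i := by
  classical
  have hne : ∀ i, NeZero (p ^ i) := fun i => ⟨pow_ne_zero _ (Fact.out : p.Prime).ne_zero⟩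
  let b := Basis.mk hind hspan.ge
  let B : Basis (Σ i : Fin (n + 1), Σ _ : ι i, Multiplicative (ZMod (p ^ (i : ℕ))))
      (ZMod (p ^ m)) ((i : Fin (n + 1)) → (ι i →₀ CycGR p m (i : ℕ))) :=
    Pi.basis fun i => Finsupp.basis fun _ => MonoidAlgebra.basis _ _
  let e := b.equiv B (Equiv.sigmaAssoc fun (i : Fin (n + 1)) (_ : ι i) =>
    Multiplicative (ZMod (p ^ (i : ℕ))))
  have he : ∀ i (a : ι i) (g : Multiplicative (ZMod (p ^ (i : ℕ)))),
      e ((T ^ (Multiplicative.toAdd g).val) (y i a)) =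
        Pi.single i (Finsupp.single a (MonoidAlgebra.single g 1)) := by
    intro i a g
    have h1 := b.equiv_apply ⟨⟨i, a⟩, g⟩ B (Equiv.sigmaAssoc fun (i : Fin (n + 1)) (_ : ι i) =>
      Multiplicative (ZMod (p ^ (i : ℕ))))
    rw [Basis.mk_apply] at h1
    refine h1.trans ?_
    simp [B, Pi.basis_apply, Equiv.sigmaAssoc]
  let f : Q →ₗ[ZMod (p ^ m)] ((i : Fin (n + 1)) → (ι i →₀ CycGR p m (i : ℕ))) :=
    LinearMap.pi fun i => (DistribSMul.toLinearMap (ZMod (p ^ m)) (ι i →₀ CycGR p m (i : ℕ))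
      (gen p m (i : ℕ))).comp ((LinearMap.proj i).comp e.toLinearMap)
  have hf : e.toLinearMap.comp T = f := by
    refine b.ext ?_
    rintro ⟨⟨i, a⟩, g⟩
    rw [Basis.mk_apply, LinearMap.comp_apply]
    change e (T _) = fun k : Fin (n + 1) => gen p m (k : ℕ) • e _ k
    rw [← pow_val_add_one_apply T (hy i a), he]
    have := he i a (Multiplicative.ofAdd (Multiplicative.toAdd g + 1))
    refine this.trans ?_
    funext k
    by_cases hk : k = i
    · subst hk
      rw [Pi.single_eq_same, Pi.single_eq_same, Finsupp.smul_single, gen_smul_single]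
    · rw [Pi.single_eq_of_ne hk, Pi.single_eq_of_ne hk, smul_zero]
  exact ⟨e.toAddEquiv, fun q => LinearMap.congr_fun hf q⟩

end Decomposition

section PowerClasses

variable {F K : Type*} [Field F] [Field K] [Algebra F K] {p n : ℕ} {σ : K ≃ₐ[F] K}

/-- The group `Kˣ / (Kˣ) ^ q` of `q`-th power classes, written additively. -/
def PowerClass (K : Type*) [Field K] (q : ℕ) : Type _ := Additive (Kˣ ⧸ powSub K q)

instance (q : ℕ) : AddCommGroup (PowerClass K q) :=
  inferInstanceAs (AddCommGroup (Additive (Kˣ ⧸ powSub K q)))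

/-- The projection of `Kˣ` onto the group of its `q`-th power classes. -/
def classHom (K : Type*) [Field K] (q : ℕ) : Additive Kˣ →+ PowerClass K q :=
  MonoidHom.toAdditive (QuotientGroup.mk' (powSub K q))

theorem classHom_surjective (q : ℕ) : Function.Surjective (classHom K q) :=
  QuotientGroup.mk'_surjective (powSub K q)

theorem classHom_eq_zero_iff {q : ℕ} {a : Additive Kˣ} :
    classHom K q a = 0 ↔ ∃ b, a = q • b := by
  refine (QuotientGroup.eq_one_iff (N := powSub K q) a.toMul).trans ?_
  exact ⟨fun ⟨b, hb⟩ => ⟨b, hb.symm⟩, fun ⟨b, hb⟩ => ⟨b, hb.symm⟩⟩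

instance (q : ℕ) : Module (ZMod q) (PowerClass K q) :=
  AddCommGroup.zmodModule fun y => by
    obtain ⟨a, rfl⟩ := classHom_surjective q y
    rw [← map_nsmul, classHom_eq_zero_iff]
    exact ⟨a, rfl⟩

/-- The action of `σ` on the `q`-th power classes. -/
noncomputable def classEnd (q : ℕ) (σ : K ≃ₐ[F] K) :
    Module.End (ZMod q) (PowerClass K q) :=
  AddMonoidHom.toZModLinearMap q (M := PowerClass K q) (M₁ := PowerClass K q)
    (MonoidHom.toAdditive (jmap q σ))

theorem classEnd_classHom (q : ℕ)
    (a : Additive Kˣ) : classEnd q σ (classHom K q a) = classHom K q (unitsEnd σ a) :=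
  rfl

theorem classEnd_pow_eq_one {q : ℕ} {N : ℕ}
    (h : unitsEnd σ ^ N = 1) : classEnd q σ ^ N = 1 := by
  ext y
  obtain ⟨a, rfl⟩ := classHom_surjective q y
  rw [map_pow_apply (classEnd_classHom q), h]
  rfl

theorem umap_normHom {i : ℕ} {x : Kˣ} (hx : x ∈ KiU p σ i) :
    umap σ (normHom p σ i x) = normHom p σ i x := by
  have h1 : normHom p σ i x = ∏ k ∈ Finset.range (p ^ i), umap (σ ^ k) x :=
    MonoidHom.finsetProd_apply _ _ _
  rw [h1, map_prod]
  have h2 := Finset.prod_range_succ (fun k => umap (σ ^ k) x) (p ^ i)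
  rw [Finset.prod_range_succ', mem_KiU.1 hx] at h2
  have h3 := mul_right_cancel h2
  rw [← h3]
  refine Finset.prod_congr rfl fun k _ => ?_
  rw [← umap_mul, ← pow_succ']

theorem mem_normFil_classEnd_iff [Fact p.Prime] (h : HilbertNinety p n (unitsEnd σ))
    {i : ℕ} (hi : i ≤ n) {y : PowerClass K p} : y ∈ normFil (classEnd p σ) i ↔
      ∃ x ∈ KiU p σ i, classHom K p (Additive.ofMul (normHom p σ i x)) = y := by
  have hnorm : ∀ x : Kˣ, (∑ k ∈ Finset.range (p ^ i), unitsEnd σ ^ k) (Additive.ofMul x) =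
      Additive.ofMul (normHom p σ i x) := by
    intro x
    rw [unitsEnd_sum_apply (σ := σ) (p ^ i) (fun k => k) x, normHom,
      MonoidHom.finsetProd_apply]
  rw [h.mem_normFil_iff (classEnd_classHom p) (fun _ => classHom_eq_zero_iff)
    (classHom_surjective p) hi]
  constructor
  · rintro ⟨a, ha, hy⟩
    exact ⟨a.toMul, mem_KiU.2 ((unitsEnd_pow_apply _ _).symm.trans ha), by
      rw [← hnorm, ofMul_toMul, hy]⟩
  · rintro ⟨x, hx, hy⟩
    exact ⟨Additive.ofMul x, by rw [unitsEnd_pow_apply, mem_KiU.1 hx], by rw [hnorm, hy]⟩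

variable [FiniteDimensional F K] [IsGalois F K]

theorem mem_FpPow_iff (h : HilbertNinety p n (unitsEnd σ))
    (hgen : ∀ τ : K ≃ₐ[F] K, τ ∈ Subgroup.zpowers σ) {x : Kˣ} :
    x ∈ FpPow F p ↔ umap σ x = x ∧ classHom K p (Additive.ofMul x) = 0 := by
  rw [classHom_eq_zero_iff]
  constructor
  · rintro ⟨y, hy, rfl⟩
    have hy' := (mem_Funits_iff hgen).1 hy
    exact ⟨by rw [powMonoidHom_apply, map_pow, hy'], Additive.ofMul y, rfl⟩
  · rintro ⟨hx, b, hb⟩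
    refine ⟨b.toMul, (mem_Funits_iff hgen).2 ?_, hb.symm⟩
    have hb' : x = b.toMul ^ p := hb
    rw [hb', map_pow] at hx
    exact h.nsmul_injective (a := Additive.ofMul (umap σ b.toMul)) (b := b) hx

variable [Fact p.Prime]

theorem mem_NiF_iff (h : HilbertNinety p n (unitsEnd σ))
    (hgen : ∀ τ : K ≃ₐ[F] K, τ ∈ Subgroup.zpowers σ) {i : ℕ} (hi : i ≤ n) {x : Kˣ} :
    x ∈ NiF p σ i ↔
      umap σ x = x ∧ classHom K p (Additive.ofMul x) ∈ normFil (classEnd p σ) i := by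
  rw [mem_normFil_classEnd_iff h hi, NiF, Subgroup.mem_sup]
  constructor
  · rintro ⟨_, ⟨y, hy, rfl⟩, z, hz, rfl⟩
    obtain ⟨hz1, hz2⟩ := (mem_FpPow_iff h hgen).1 hz
    exact ⟨by rw [map_mul, hz1, umap_normHom hy], y, hy, by rw [ofMul_mul, map_add, hz2, add_zero]⟩
  · rintro ⟨hx, y, hy, hxy⟩
    refine ⟨_, ⟨y, hy, rfl⟩, x / normHom p σ i y, (mem_FpPow_iff h hgen).2 ⟨?_, ?_⟩,
      mul_div_cancel _ _⟩
    · rw [map_div, hx, umap_normHom hy]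
    · rw [ofMul_div, map_sub, hxy, sub_self]

theorem eKF_eq_rank
    (h : HilbertNinety p n (unitsEnd σ))
    (hgen : ∀ τ : K ≃ₐ[F] K, τ ∈ Subgroup.zpowers σ) {i : ℕ} (hi : i ≤ n) :
    eKF p n σ i = Module.rank (ZMod p)
      ((normFil (classEnd p σ) i).map (normFil (classEnd p σ) (i + 1)).mkQ) := by
  have hsurj : ∀ y ∈ normFil (classEnd p σ) i,
      ∃ x ∈ NiF p σ i, classHom K p (Additive.ofMul x) = y := by
    intro y hy
    obtain ⟨x, hx, rfl⟩ := (mem_normFil_classEnd_iff h hi).1 hy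
    exact ⟨_, Subgroup.mem_sup_left ⟨x, hx, rfl⟩, rfl⟩
  have hmem := fun x hx => ((mem_NiF_iff (x := x) h hgen hi).1 hx)
  rw [eKF]
  split_ifs with hin
  · exact fpdim_quotient_eq_rank (classHom K p) _ _ _ _ (fun x hx => (hmem x hx).2) hsurj
      (fun x hx => ((mem_NiF_iff h hgen hin).1 hx).2)
      (fun x hx hx' => (mem_NiF_iff h hgen hin).2 ⟨(hmem x hx).1, hx'⟩)
  · obtain rfl : i = n := le_antisymm hi (not_lt.1 hin)
    have hbot : normFil (classEnd p σ) (i + 1) = ⊥ :=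
      normFil_eq_bot (classEnd_pow_eq_one h.pow_eq_one) (Nat.lt_succ_self i)
    refine fpdim_quotient_eq_rank (classHom K p) _ _ _ _ (fun x hx => (hmem x hx).2) hsurj
      (fun x hx => ?_) (fun x hx hx' => ?_)
    · rw [((mem_FpPow_iff h hgen).1 hx).2]
      exact zero_mem _
    · rw [hbot, Submodule.mem_bot] at hx'
      exact (mem_FpPow_iff h hgen).2 ⟨(hmem x hx).1, hx'⟩

end PowerClasses

theorem exists_equiv_of_hilbertNinety {F : Type*} {K : Type w} [Field F] [Field K] [Algebra F K]
    [FiniteDimensional F K] [IsGalois F K] {p n : ℕ} [Fact p.Prime] {σ : K ≃ₐ[F] K}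
    (hgen : ∀ τ : K ≃ₐ[F] K, τ ∈ Subgroup.zpowers σ) (h : HilbertNinety p n (unitsEnd σ))
    (m : ℕ) :
    ∃ ι : Fin (n + 1) → Type w, (∀ i, Cardinal.mk (ι i) = eKF p n σ i) ∧
      ∃ e : PowerClass K (p ^ m) ≃+
          ((i : Fin (n + 1)) → (ι i →₀ CycGR p m (i : ℕ))),
        ∀ q, e (classEnd (p ^ m) σ q) = fun i : Fin (n + 1) => gen p m (i : ℕ) • e q i := by
  have hS : ∀ a, classEnd p σ (classHom K p a) = classHom K p (unitsEnd σ a) :=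
    classEnd_classHom p
  have hπ : ∀ q, ∀ a, classHom K q a = 0 ↔ ∃ b, a = q • b := fun q _ => classHom_eq_zero_iff
  obtain ⟨ι, x, hcard, hx, hind, hspan⟩ := exists_basis_orbitFamily (classEnd p σ) (n := n)
    (classEnd_pow_eq_one h.pow_eq_one)
    (fun i hi y hy => h.exists_norm_lift hS (hπ p) (classHom_surjective p) hi hy)
  choose y hy hyx using fun (i : Fin (n + 1)) (a : ι i) =>
    h.exists_fixed_lift hS (hπ p) (classHom_surjective p) (Nat.lt_succ_iff.1 i.2) (hx i a)
  let W : (Σ a : Σ i, ι i, Multiplicative (ZMod (p ^ (a.1 : ℕ)))) → Additive Kˣ := fun j =>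
    (unitsEnd σ ^ (Multiplicative.toAdd j.2).val) (y j.1.1 j.1.2)
  have hW : classHom K p ∘ W =
      orbitFamily (classEnd p σ) (fun a : Σ i, ι i => (a.1 : ℕ)) fun a => x a.1 a.2 := by
    funext j
    change classHom K p (W j) = (classEnd p σ ^ _) (x j.1.1 j.1.2)
    rw [← hyx, map_pow_apply hS]
  rw [← hW] at hind hspan
  obtain ⟨hind', hspan'⟩ := basis_of_basis_mod_prime m h.torsion_free (classHom K p) (hπ p)
    (classHom K (p ^ m)) (hπ _) (classHom_surjective _) W hind hspan
  have hSm := map_pow_apply (classEnd_classHom (K := K) (σ := σ) (p ^ m))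
  refine ⟨ι, fun i => (hcard i).trans (eKF_eq_rank h hgen (Nat.lt_succ_iff.1 i.2)).symm,
    exists_equiv_of_basis (classEnd (p ^ m) σ) (fun i a => classHom K (p ^ m) (y i a)) ?_ ?_ ?_⟩
  · intro i a
    rw [hSm, hy]
  · simp_rw [hSm]
    exact hind'
  · simp_rw [hSm]
    exact hspan'

end MSS


/-- **Theorem 3.**  Suppose `F` contains no primitive `p`-th root of unity (and
`char F ≠ p`).  Then for every `m ≥ 1`, `J_m ≅ ⨁_{i=0}^n Y_i` as `R_m[G]`-modules,
where each `Y_i` is a free `R_m[G_i]`-module of rank `e_i(K/F)`. -/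
theorem statement_2 {F : Type u} {K : Type v} [Field F] [Field K] [Algebra F K]
    [IsGalois F K] [FiniteDimensional F K]
    (p n : ℕ) (hp : p.Prime) (hn : 0 < n)
    (σ : K ≃ₐ[F] K) (horder : orderOf σ = p ^ n)
    (hgen : ∀ τ : K ≃ₐ[F] K, τ ∈ Subgroup.zpowers σ)
    (hchar : ringChar F ≠ p)
    (hnoroot : ∀ x : F, ¬ IsPrimitiveRoot x p) :
    ∀ m : ℕ, 0 < m →
      ∃ ι : Fin (n + 1) → Type v,
        (∀ i : Fin (n + 1), Cardinal.mk (ι i) = MSS.eKF p n σ (i : ℕ)) ∧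
        ∃ e : Additive (Kˣ ⧸ MSS.powSub K (p ^ m)) ≃+
              ((i : Fin (n + 1)) → (ι i →₀ MSS.CycGR p m (i : ℕ))),
          ∀ x : Kˣ ⧸ MSS.powSub K (p ^ m),
            e (Additive.ofMul (MSS.jmap (p ^ m) σ x)) =
              fun i : Fin (n + 1) =>
                MSS.gen p m (i : ℕ) • e (Additive.ofMul x) i := by
  have : Fact p.Prime := ⟨hp⟩
  intro m _
  obtain ⟨ι, hι, e, he⟩ := MSS.exists_equiv_of_hilbertNinety hgen
    (MSS.hilbertNinety_unitsEnd hp horder hgen hnoroot) m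
  exact ⟨ι, hι, e, fun x => he (Additive.ofMul x)⟩
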